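/- Let i ≥ 0 be an integer, let V and Q be finite-dimensional real vector spaces carrying real Hodge structures of weights 2i+1 and 4i+2 respectively, and let μ: Λ²V → Q be a linear map whose complexification is a morphism of Hodge structures, i.e. μ_ℂ(V^{p,q} ∧ V^{p',q'}) ⊆ Q^{p+p',q+q'} for all (p,q), (p',q') with p+q = p'+q' = 2i+1. Then there exists a complex vector subspace W ⊆ V_ℂ with dim_ℂ W = (1/2) dim_ℂ V_ℂ such that the rank of the restriction of μ_ℂ to Λ²W is at most (1/2) rank μ. -/

import Mathlib

open TensorProduct

noncomputable def conjR (V : Type) [AddCommGroup V] [Module ℝ V] :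
    ℂ ⊗[ℝ] V →ₗ[ℝ] ℂ ⊗[ℝ] V :=
  LinearMap.rTensor V Complex.conjAe.toLinearMap

structure HodgeStructureR (V : Type) [AddCommGroup V] [Module ℝ V] (w : ℤ) where
  H : ℤ → Submodule ℂ (ℂ ⊗[ℝ] V)
  internal : DirectSum.IsInternal H
  conj_mem : ∀ p : ℤ, ∀ x ∈ H p, conjR V x ∈ H (w - p)

theorem conjR_tmul {V : Type} [AddCommGroup V] [Module ℝ V] (z : ℂ) (v : V) :
    conjR V (z ⊗ₜ[ℝ] v) = (starRingEnd ℂ z) ⊗ₜ[ℝ] v := by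
  simp [conjR]

theorem conjR_smul {V : Type} [AddCommGroup V] [Module ℝ V] (c : ℂ) (x : ℂ ⊗[ℝ] V) :
    conjR V (c • x) = starRingEnd ℂ c • conjR V x := by
  induction x with
  | zero => simp
  | tmul z v => simp [conjR_tmul, TensorProduct.smul_tmul']
  | add a b ha hb => simp only [smul_add, map_add, ha, hb]

theorem conjR_conjR {V : Type} [AddCommGroup V] [Module ℝ V] (x : ℂ ⊗[ℝ] V) :
    conjR V (conjR V x) = x := by
  induction x with
  | zero => simp
  | tmul z v => simp [conjR_tmul]
  | add a b ha hb => simp only [map_add, ha, hb]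

theorem finrank_le_of_conjR_mem {V : Type} [AddCommGroup V] [Module ℝ V]
    [FiniteDimensional ℝ V] {A B : Submodule ℂ (ℂ ⊗[ℝ] V)}
    (h : ∀ x ∈ A, conjR V x ∈ B) : Module.finrank ℂ A ≤ Module.finrank ℂ B := by
  have hA := Module.finrank_mul_finrank ℝ ℂ A
  have hB := Module.finrank_mul_finrank ℝ ℂ B
  let f : A.restrictScalars ℝ →ₗ[ℝ] B.restrictScalars ℝ := (conjR V).restrict h
  have hf : Function.Injective f := fun x y hxy => Subtype.ext
    (Function.LeftInverse.injective conjR_conjR (congrArg Subtype.val hxy))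
  have : Module.Finite ℝ B := Module.Finite.trans ℂ B
  have hle : Module.finrank ℝ A ≤ Module.finrank ℝ B :=
    LinearMap.finrank_le_finrank_of_injective hf
  rw [← hA, ← hB, Complex.finrank_real_complex] at hle
  omega

theorem conjR_map₂ {V Q : Type} [AddCommGroup V] [Module ℝ V] [AddCommGroup Q] [Module ℝ Q]
    {μ : V →ₗ[ℝ] V →ₗ[ℝ] Q} {μC : (ℂ ⊗[ℝ] V) →ₗ[ℂ] (ℂ ⊗[ℝ] V) →ₗ[ℂ] (ℂ ⊗[ℝ] Q)}
    (hμ : ∀ (z w : ℂ) (x y : V), μC (z ⊗ₜ[ℝ] x) (w ⊗ₜ[ℝ] y) = (z * w) ⊗ₜ[ℝ] μ x y)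
    (x y : ℂ ⊗[ℝ] V) : conjR Q (μC x y) = μC (conjR V x) (conjR V y) := by
  induction x with
  | zero => simp
  | add a b ha hb => simp only [map_add, LinearMap.add_apply, ha, hb]
  | tmul z v =>
    induction y with
    | zero => simp
    | add a b ha hb => simp only [map_add, ha, hb]
    | tmul w u => simp only [hμ, conjR_tmul, map_mul]

theorem map₂_mem_baseChange {V Q : Type} [AddCommGroup V] [Module ℝ V] [AddCommGroup Q]
    [Module ℝ Q] {μ : V →ₗ[ℝ] V →ₗ[ℝ] Q}
    {μC : (ℂ ⊗[ℝ] V) →ₗ[ℂ] (ℂ ⊗[ℝ] V) →ₗ[ℂ] (ℂ ⊗[ℝ] Q)}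
    (hμ : ∀ (z w : ℂ) (x y : V), μC (z ⊗ₜ[ℝ] x) (w ⊗ₜ[ℝ] y) = (z * w) ⊗ₜ[ℝ] μ x y)
    {R : Submodule ℝ Q} (hR : ∀ x y, μ x y ∈ R) (x y : ℂ ⊗[ℝ] V) :
    μC x y ∈ R.baseChange ℂ := by
  induction x with
  | zero => simp
  | add a b ha hb => simpa only [map_add, LinearMap.add_apply] using add_mem ha hb
  | tmul z v =>
    induction y with
    | zero => simp
    | add a b ha hb => simpa only [map_add] using add_mem ha hb
    | tmul w u => rw [hμ]; exact Submodule.tmul_mem_baseChange_of_mem _ (hR v u)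

theorem finrank_submodule_baseChange {Q : Type} [AddCommGroup Q] [Module ℝ Q]
    (R : Submodule ℝ Q) : Module.finrank ℂ (R.baseChange ℂ) = Module.finrank ℝ R :=
  (Submodule.toBaseChange.toLinearEquiv ℂ R).finrank_eq.symm.trans Module.finrank_baseChange

namespace HodgeStructureR

variable {V : Type} [AddCommGroup V] [Module ℝ V] {w : ℤ}

/-- The sum of the Hodge pieces whose first index lies in `s`. -/
noncomputable def part (h : HodgeStructureR V w) (s : Set ℤ) : Submodule ℂ (ℂ ⊗[ℝ] V) := ⨆ p ∈ s, h.H p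

theorem le_part (h : HodgeStructureR V w) {s : Set ℤ} {p : ℤ} (hp : p ∈ s) :
    h.H p ≤ h.part s := le_biSup h.H hp

theorem disjoint_part (h : HodgeStructureR V w) {s t : Set ℤ} (hst : Disjoint s t) :
    Disjoint (h.part s) (h.part t) :=
  h.internal.submodule_iSupIndep.disjoint_biSup_biSup hst

theorem isCompl_part (h : HodgeStructureR V w) {s t : Set ℤ} (hst : IsCompl s t) :
    IsCompl (h.part s) (h.part t) := by
  refine ⟨h.disjoint_part hst.disjoint, codisjoint_iff_le_sup.2 ?_⟩
  rw [← h.internal.submodule_iSup_eq_top]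
  refine iSup_le fun p => ?_
  have hp : p ∈ s ∪ t := hst.sup_eq_top.ge (Set.mem_univ p)
  exact hp.elim (fun hs => (h.le_part hs).trans le_sup_left)
    fun ht => (h.le_part ht).trans le_sup_right

theorem part_induction (h : HodgeStructureR V w) {s : Set ℤ} {P : ℂ ⊗[ℝ] V → Prop}
    (mem : ∀ p ∈ s, ∀ x ∈ h.H p, P x) (zero : P 0) (add : ∀ x y, P x → P y → P (x + y))
    {x : ℂ ⊗[ℝ] V} (hx : x ∈ h.part s) : P x := by
  rw [part, iSup_subtype'] at hx
  exact Submodule.iSup_induction (motive := P) _ hx (fun p => mem p p.2) zero add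

theorem conjR_mem_part (h : HodgeStructureR V w) {s t : Set ℤ} (hst : ∀ p ∈ s, w - p ∈ t)
    {x : ℂ ⊗[ℝ] V} (hx : x ∈ h.part s) : conjR V x ∈ h.part t := by
  refine h.part_induction (P := fun x => conjR V x ∈ h.part t) ?_ ?_ ?_ hx
  · exact fun p hp x hx => h.le_part (hst p hp) (h.conj_mem p x hx)
  · simp
  · intro x y hx hy
    rw [map_add]
    exact add_mem hx hy

theorem map₂_mem_part {Q : Type} [AddCommGroup Q] [Module ℝ Q] {w' : ℤ}
    (h : HodgeStructureR V w) (h' : HodgeStructureR Q w')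
    {f : (ℂ ⊗[ℝ] V) →ₗ[ℂ] (ℂ ⊗[ℝ] V) →ₗ[ℂ] (ℂ ⊗[ℝ] Q)}
    (hf : ∀ p p' : ℤ, ∀ x ∈ h.H p, ∀ y ∈ h.H p', f x y ∈ h'.H (p + p'))
    {s t : Set ℤ} (hst : ∀ p ∈ s, ∀ p' ∈ s, p + p' ∈ t) {x y : ℂ ⊗[ℝ] V}
    (hx : x ∈ h.part s) (hy : y ∈ h.part s) : f x y ∈ h'.part t := by
  refine h.part_induction (P := fun x => f x y ∈ h'.part t) (fun p hp x hx => ?_) ?_ ?_ hx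
  · refine h.part_induction (P := fun y => f x y ∈ h'.part t) ?_ ?_ ?_ hy
    · exact fun p' hp' y hy => h'.le_part (hst p hp p' hp') (hf p p' x hx y hy)
    · simp
    · intro a b ha hb
      rw [map_add]
      exact add_mem ha hb
  · simp
  · intro a b ha hb
    rw [map_add, LinearMap.add_apply]
    exact add_mem ha hb

end HodgeStructureR

theorem stmt15 (i : ℕ) (V Q : Type) [AddCommGroup V] [Module ℝ V]
    [AddCommGroup Q] [Module ℝ Q] [FiniteDimensional ℝ V] [FiniteDimensional ℝ Q]
    (HV : HodgeStructureR V (2 * i + 1)) (HQ : HodgeStructureR Q (4 * i + 2))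
    -- μ is an alternating bilinear map, i.e. a linear map Λ²V → Q
    (μ : V →ₗ[ℝ] V →ₗ[ℝ] Q) (halt : ∀ x y : V, μ x y = - μ y x)
    -- μC is its complexification
    (μC : (ℂ ⊗[ℝ] V) →ₗ[ℂ] (ℂ ⊗[ℝ] V) →ₗ[ℂ] (ℂ ⊗[ℝ] Q))
    (hext : ∀ x y : V, μC ((1 : ℂ) ⊗ₜ[ℝ] x) ((1 : ℂ) ⊗ₜ[ℝ] y) = (1 : ℂ) ⊗ₜ[ℝ] (μ x y))
    -- μ is a morphism of Hodge structures
    (hmor : ∀ p p' : ℤ, ∀ x ∈ HV.H p, ∀ y ∈ HV.H p', μC x y ∈ HQ.H (p + p')) :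
    ∃ W : Submodule ℂ (ℂ ⊗[ℝ] V),
      2 * Module.finrank ℂ ↥W = Module.finrank ℂ (ℂ ⊗[ℝ] V) ∧
      2 * Module.finrank ℂ
            ↥(Submodule.span ℂ {q : ℂ ⊗[ℝ] Q | ∃ x ∈ W, ∃ y ∈ W, μC x y = q}) ≤
        Module.finrank ℝ ↥(Submodule.span ℝ {q : Q | ∃ x y : V, μ x y = q}) := by
  have hμ : ∀ (z w : ℂ) (x y : V), μC (z ⊗ₜ[ℝ] x) (w ⊗ₜ[ℝ] y) = (z * w) ⊗ₜ[ℝ] μ x y := by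
    intro z w x y
    have hz : ∀ (z : ℂ) (x : V), z ⊗ₜ[ℝ] x = z • ((1 : ℂ) ⊗ₜ[ℝ] x) := fun z x => by
      rw [TensorProduct.smul_tmul', smul_eq_mul, mul_one]
    rw [hz z x, hz w y, map_smul, map_smul, LinearMap.smul_apply, hext, smul_smul, mul_comm w z,
      TensorProduct.smul_tmul', smul_eq_mul, mul_one]
  set W := HV.part (Set.Ioi (i : ℤ))
  set W' := HV.part (Set.Iic (i : ℤ))
  have hconj : ∀ x ∈ W, conjR V x ∈ W' := fun x hx =>
    HV.conjR_mem_part (fun p hp => by simp only [Set.mem_Ioi, Set.mem_Iic] at *; omega) hx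
  have hconj' : ∀ x ∈ W', conjR V x ∈ W := fun x hx =>
    HV.conjR_mem_part (fun p hp => by simp only [Set.mem_Ioi, Set.mem_Iic] at *; omega) hx
  refine ⟨W, ?_, ?_⟩
  · have hcompl : IsCompl W W' := HV.isCompl_part (by
      rw [← Set.compl_Ioi]; exact isCompl_compl)
    have := Submodule.finrank_add_eq_of_isCompl hcompl
    have := finrank_le_of_conjR_mem hconj
    have := finrank_le_of_conjR_mem hconj'
    omega
  · set R := Submodule.span ℝ {q : Q | ∃ x y : V, μ x y = q}
    let S (U : Submodule ℂ (ℂ ⊗[ℝ] V)) : Submodule ℂ (ℂ ⊗[ℝ] Q) :=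
      Submodule.span ℂ {q | ∃ x ∈ U, ∃ y ∈ U, μC x y = q}
    have hSR (U) : S U ≤ R.baseChange ℂ := Submodule.span_le.2 <| by
      rintro _ ⟨x, -, y, -, rfl⟩
      exact map₂_mem_baseChange hμ (R := R)
        (fun x y => Submodule.subset_span ⟨x, y, rfl⟩) x y
    have hS : S W ≤ HQ.part (Set.Ioi (2 * i + 1 : ℤ)) := Submodule.span_le.2 <| by
      rintro _ ⟨x, hx, y, hy, rfl⟩
      exact HV.map₂_mem_part HQ hmor
        (fun p hp p' hp' => by simp only [Set.mem_Ioi] at *; omega) hx hy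
    have hS' : S W' ≤ HQ.part (Set.Iic (2 * i + 1 : ℤ)) := Submodule.span_le.2 <| by
      rintro _ ⟨x, hx, y, hy, rfl⟩
      exact HV.map₂_mem_part HQ hmor
        (fun p hp p' hp' => by simp only [Set.mem_Iic] at *; omega) hx hy
    have hdisj : Disjoint (S W) (S W') :=
      (HQ.disjoint_part (by rw [← Set.compl_Ioi]; exact disjoint_compl_right)).mono hS hS'
    have hSconj : ∀ q ∈ S W, conjR Q q ∈ S W' := fun q hq => by
      induction hq using Submodule.span_induction with
      | mem q hq =>
        obtain ⟨x, hx, y, hy, rfl⟩ := hq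
        rw [conjR_map₂ hμ]
        exact Submodule.subset_span ⟨_, hconj x hx, _, hconj y hy, rfl⟩
      | zero => simp
      | add a b _ _ ha hb => rw [map_add]; exact add_mem ha hb
      | smul c a _ ha => rw [conjR_smul]; exact Submodule.smul_mem _ _ ha
    have hle := finrank_le_of_conjR_mem hSconj
    have hsum := Submodule.finrank_sup_add_finrank_inf_eq (S W) (S W')
    rw [hdisj.eq_bot, finrank_bot] at hsum
    have hsup := Submodule.finrank_mono (sup_le (hSR W) (hSR W'))
    have hR := finrank_submodule_baseChange R
    change 2 * Module.finrank ℂ (S W) ≤ Module.finrank ℝ R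
    omega
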